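/- Let r, c > 0, λ̄ > λ̲ > 0, 0 < b₁* < b₂* < 1, and let u solve the stopper's two-regime boundary value problem: (λ̄²p²(1−p)²/2)u'' − ru + pλ̄ − c = 0 on (b₁*, b₂*), (λ̲²p²(1−p)²/2)u'' − ru + pλ̲ − c = 0 on (b₂*, 1), u = 0 on [0, b₁*], u(1) = (λ̲−c)/r, u ∈ C¹(b₁*,1) ∩ C²((b₁*,b₂*)∪(b₂*,1)), with u'(b₁*+) = 0 and b₁* < c/λ̄. If additionally c ≤ (1−α₁(λ̲))λ̄ + α₁(λ̲)λ̲ where α₁(λ̲) = 1/2 + (1/2)√(8r/λ̲²+1), then u(p) > 0 for all p ∈ (b₁*, 1]. -/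

import Mathlib

noncomputable def alpha1 (r lam : ℝ) : ℝ := 1/2 + Real.sqrt (8*r/lam^2 + 1) / 2

open Set Filter Topology

/-- Strict convexity to the right of a critical point makes `u` strictly larger. -/
theorem aux_conv (u u' u'' : ℝ → ℝ) (a : ℝ)
    (h : ∀ᶠ p in 𝓝[>] a, HasDerivAt u (u' p) p ∧ HasDerivAt u' (u'' p) p ∧ 0 < u'' p)
    (hc : ContinuousAt u a) (ht : Tendsto u' (𝓝[>] a) (𝓝 0)) :
    ∀ᶠ p in 𝓝[>] a, u a < u p := by
  obtain ⟨d, had, hd⟩ := mem_nhdsGT_iff_exists_Ioo_subset.1 h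
  have had : a < d := had
  have hmono : StrictMonoOn u' (Ioo a d) := by
    apply strictMonoOn_of_deriv_pos (convex_Ioo a d)
    · intro x hx
      exact (hd hx).2.1.continuousAt.continuousWithinAt
    · intro x hx
      rw [interior_Ioo] at hx
      rw [(hd hx).2.1.deriv]
      exact (hd hx).2.2
  have hnn : ∀ s ∈ Ioo a d, 0 ≤ u' s := by
    intro s hs
    apply le_of_tendsto ht
    filter_upwards [Ioo_mem_nhdsGT hs.1] with t ht
    exact (hmono ⟨ht.1, ht.2.trans hs.2⟩ hs ht.2).le
  have hpos : ∀ s ∈ Ioo a d, 0 < u' s := by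
    intro s hs
    have h1 : (a + s) / 2 ∈ Ioo a d := ⟨by linarith [hs.1], by linarith [hs.1, hs.2]⟩
    exact (hnn _ h1).trans_lt (hmono h1 hs (by linarith [hs.1]))
  have hu : StrictMonoOn u (Ico a d) := by
    apply strictMonoOn_of_deriv_pos (convex_Ico a d)
    · intro x hx
      rcases eq_or_lt_of_le hx.1 with h1 | h1
      · rw [← h1]; exact hc.continuousWithinAt
      · exact (hd ⟨h1, hx.2⟩).1.continuousAt.continuousWithinAt
    · intro x hx
      rw [interior_Ico] at hx
      rw [(hd hx).1.deriv]
      exact hpos x hx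
  filter_upwards [Ioo_mem_nhdsGT had] with p hp
  exact hu ⟨le_rfl, had⟩ ⟨hp.1.le, hp.2⟩ hp.1

/-- Behaviour near `1`: the quantity `X` must not be negative. -/
theorem aux_end (v v' v'' : ℝ → ℝ) (q a : ℝ) (hq0 : 0 < q) (hq1 : q < 1) (ha : 1 < a)
    (hcv : ContinuousOn v (Icc q 1)) (hv1 : v 1 = 0)
    (hcv' : ContinuousOn v' (Ico q 1))
    (h1 : ∀ p ∈ Ioo q 1, HasDerivAt v (v' p) p)
    (h2 : ∀ p ∈ Ioo q 1, HasDerivAt v' (v'' p) p)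
    (hode : ∀ p ∈ Ioo q 1, p^2*(1-p)^2 * v'' p = a*(a-1) * v p) :
    0 ≤ q*(1-q)*v' q + (q+a-1)*v q := by
  by_contra hneg
  push Not at hneg
  set X : ℝ → ℝ := fun p => p*(1-p)*v' p + (p+a-1)*v p with hX
  have hXq : X q < 0 := hneg
  have hXc : ContinuousOn X (Ico q 1) := by
    have := hcv.mono Ico_subset_Icc_self
    fun_prop
  have hXd : ∀ p ∈ Ioo q 1, HasDerivAt X ((a-p)*X p/(p*(1-p))) p := by
    intro p hp
    have e1 := ((((hasDerivAt_id p).mul ((hasDerivAt_id p).const_sub 1)).mul (h2 p hp)).add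
      ((((hasDerivAt_id p).add_const a).sub_const 1).mul (h1 p hp)))
    have hp0 : 0 < p := hq0.trans hp.1
    have hp1 : 0 < 1 - p := by linarith [hp.2]
    refine e1.congr_deriv ?_
    have ho := hode p hp
    rw [eq_div_iff (by positivity)]
    simp only [hX, id, Pi.mul_apply]
    linear_combination ho
  have hsq : MonotoneOn (fun p => X p * X p) (Ico q 1) := by
    apply monotoneOn_of_deriv_nonneg (convex_Ico q 1)
    · exact hXc.mul hXc
    · intro x hx
      rw [interior_Ico] at hx
      exact ((hXd x hx).mul (hXd x hx)).differentiableAt.differentiableWithinAt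
    · intro x hx
      rw [interior_Ico] at hx
      have := ((hXd x hx).mul (hXd x hx)).deriv
      change 0 ≤ deriv (X * X) x
      rw [this]
      have hp0 : 0 < x := hq0.trans hx.1
      have hp1 : 0 < 1 - x := by linarith [hx.2]
      have hp2 : 0 < a - x := by linarith [hx.2]
      have : (a - x) * X x / (x * (1 - x)) * X x + X x * ((a - x) * X x / (x * (1 - x)))
        = 2 * ((a-x)/(x*(1-x))) * (X x * X x) := by ring
      rw [this]
      have := mul_self_nonneg (X x)
      positivity
  have hXneg : ∀ p ∈ Ico q 1, X p < 0 := by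
    intro p hp
    by_contra hcon
    push Not at hcon
    have hsub : Icc q p ⊆ Ico q 1 := fun y hy => ⟨hy.1, hy.2.trans_lt hp.2⟩
    obtain ⟨s, hs, hs0⟩ := intermediate_value_Icc hp.1 (hXc.mono hsub) ⟨hXq.le, hcon⟩
    have h3 := hsq ⟨le_rfl, hq1⟩ (hsub hs) hs.1
    simp only [hs0] at h3
    nlinarith
  have hXle : ∀ p ∈ Ico q 1, X p ≤ X q := by
    intro p hp
    have h3 := hsq ⟨le_rfl, hq1⟩ hp hp.1
    have h4 := hXneg p hp
    simp only at h3
    nlinarith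
  set δ := -X q with hδ
  have hδ0 : 0 < δ := by linarith
  -- smallness of v near 1
  have hlim := hcv 1 ⟨hq1.le, le_rfl⟩
  obtain ⟨ε, hε, hεs⟩ : ∃ ε, 0 < ε ∧ ε * (a + 8) < δ :=
    ⟨δ / (2 * (a + 8)), by positivity, by
      have : a + 8 ≠ 0 := by positivity
      field_simp; linarith⟩
  rw [Metric.continuousWithinAt_iff] at hlim
  obtain ⟨η, hη, hηs⟩ := hlim ε hε
  have hsmall : ∀ p, q ≤ p → p ≤ 1 → 1 - η < p → |v p| < ε := by
    intro p h3 h4 h5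
    have := hηs (x := p) ⟨h3, h4⟩ (by rw [Real.dist_eq, abs_lt]; constructor <;> linarith)
    rwa [hv1, Real.dist_eq, sub_zero] at this
  obtain ⟨p, hp, hp1⟩ : ∃ p, max q (1 - η) < p ∧ p < 1 := exists_between (by
    apply max_lt hq1; linarith)
  have hpq : q < p := (le_max_left _ _).trans_lt hp
  have hpη : 1 - η < p := (le_max_right _ _).trans_lt hp
  obtain ⟨s, hs, hse⟩ := exists_hasDerivAt_eq_slope v v' (show p < (1+p)/2 by linarith)
    (hcv.mono (fun y hy => ⟨by linarith [hy.1], by linarith [hy.2]⟩))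
    (fun y hy => h1 y ⟨by linarith [hy.1], by linarith [hy.2]⟩)
  have hs1 : s < 1 := by linarith [hs.2]
  have b1 := abs_lt.1 (hsmall p hpq.le hp1.le hpη)
  have b2 := abs_lt.1 (hsmall ((1+p)/2) (by linarith) (by linarith) (by linarith))
  have b3 := abs_lt.1 (hsmall s (by linarith [hs.1]) hs1.le (by linarith [hs.1]))
  have hXs := hXle s ⟨by linarith [hs.1], hs1⟩
  have hXs' : s*(1-s)*v' s + (s+a-1)*v s ≤ -δ := by
    have : X s = s*(1-s)*v' s + (s+a-1)*v s := rfl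
    linarith
  have hs0 : 0 < s := by linarith [hs.1]
  have hv's : v' s * (1 - p) = 2 * (v ((1+p)/2) - v p) := by
    have h6 : (1+p)/2 - p ≠ 0 := by intro h; linarith
    rw [eq_div_iff h6] at hse
    linear_combination 2 * hse
  have k1 : v' s * (1-p) > -(4*ε) := by rw [hv's]; linarith
  have k2 : (s+a-1)*v s ≥ -(a*ε) := by
    have : (s+a-1)*(v s + ε) ≥ 0 := mul_nonneg (by linarith) (by linarith)
    nlinarith
  have k3 : s*(1-s)*v' s ≥ -(4*ε) := by
    rcases le_or_gt 0 (v' s) with h5 | h5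
    · have : 0 ≤ s*(1-s)*v' s := mul_nonneg (mul_nonneg hs0.le (by linarith)) h5
      linarith
    · have : s*(1-s) ≤ 1 - p := by nlinarith [hs.1]
      nlinarith
  nlinarith

theorem stmt19 (r c l L b1 b2 : ℝ) (u u' u'' : ℝ → ℝ)
    (hr : 0 < r) (hc : 0 < c) (hl : 0 < l) (hlL : l < L)
    (hb1 : 0 < b1) (hb12 : b1 < b2) (hb2 : b2 < 1)
    (hzero : ∀ p ∈ Set.Icc (0:ℝ) b1, u p = 0)
    (hcont : ContinuousOn u (Set.Ioc 0 1))
    (hd1 : ∀ p ∈ Set.Ioo b1 1, HasDerivAt u (u' p) p)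
    (hC1 : ContinuousOn u' (Set.Ioo b1 1))
    (hd2 : ∀ p ∈ Set.Ioo b1 b2 ∪ Set.Ioo b2 1, HasDerivAt u' (u'' p) p)
    (hODE1 : ∀ p ∈ Set.Ioo b1 b2,
      L^2*p^2*(1-p)^2/2 * u'' p - r * u p + p*L - c = 0)
    (hODE2 : ∀ p ∈ Set.Ioo b2 1,
      l^2*p^2*(1-p)^2/2 * u'' p - r * u p + p*l - c = 0)
    (hu1 : u 1 = (l - c)/r)
    (hu'b1 : Filter.Tendsto u' (nhdsWithin b1 (Set.Ioi b1)) (nhds 0))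
    (hb1c : b1 < c/L)
    (hparam : c ≤ (1 - alpha1 r l) * L + alpha1 r l * l) :
    ∀ p ∈ Set.Ioc b1 1, 0 < u p := by
  have hL : 0 < L := hl.trans hlL
  set a := alpha1 r l with ha
  have harg : 1 < 8*r/l^2 + 1 := by
    have : 0 < 8*r/l^2 := by positivity
    linarith
  have hsq1 : 1 < Real.sqrt (8*r/l^2 + 1) := by
    rw [Real.lt_sqrt (by norm_num)]; linarith
  have ha1 : 1 < a := by
    rw [ha, alpha1]; linarith
  have haa : a * (a - 1) = 2*r/l^2 := by
    have := Real.mul_self_sqrt (show 0 ≤ 8*r/l^2 + 1 by linarith)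
    rw [ha, alpha1]
    have e : 8*r/l^2 = 4 * (2*r/l^2) := by ring
    nlinarith
  have hcl : c < l := by nlinarith
  have hu1pos : 0 < u 1 := by
    rw [hu1]; exact div_pos (by linarith) hr
  set m := c / L with hm
  have hmL : m * L = c := by rw [hm]; field_simp
  have hm1 : m < 1 := by rw [hm, div_lt_one hL]; linarith
  have hm0 : 0 < m := by positivity
  have hca : ∀ p, 0 < p → p < 1 → ContinuousAt u p := fun p h0 h1 =>
    hcont.continuousAt (Ioc_mem_nhds h0 h1)
  have hub1 : u b1 = 0 := hzero b1 ⟨hb1.le, le_rfl⟩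
  -- growth to the right of a critical point
  have hgrow : ∀ η, b1 ≤ η → η < m → 0 ≤ u η → Tendsto u' (𝓝[>] η) (𝓝 0) →
      ∀ᶠ p in 𝓝[>] η, u η < u p := by
    intro η hη hηm hu0 ht
    have hηc : ContinuousAt u η := hca η (by linarith) (by linarith)
    apply aux_conv u u' u'' η _ hηc ht
    have hpos : ∀ᶠ p in 𝓝[>] η, 0 < r * u p - p * L + c := by
      have : ContinuousAt (fun p => r * u p - p * L + c) η := by fun_prop
      refine (this.eventually (lt_mem_nhds (?_ : 0 < r * u η - η * L + c))).filter_mono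
        nhdsWithin_le_nhds
      nlinarith
    rcases lt_or_ge η b2 with h2 | h2
    · filter_upwards [hpos, Ioo_mem_nhdsGT h2] with p hp hpI
      have hpI' : p ∈ Ioo b1 b2 := ⟨by linarith [hpI.1], hpI.2⟩
      have hp1 : 0 < 1 - p := by linarith [hpI.2]
      have hp0 : 0 < p := by linarith [hpI'.1]
      refine ⟨hd1 p ⟨hpI'.1, by linarith⟩, hd2 p (Or.inl hpI'), ?_⟩
      have ho := hODE1 p hpI'
      have : 0 < L^2*p^2*(1-p)^2/2 * u'' p := by linarith
      exact pos_of_mul_pos_right this (by positivity)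
    · filter_upwards [hpos, Ioo_mem_nhdsGT (show η < 1 by linarith)] with p hp hpI
      have hpI' : p ∈ Ioo b2 1 := ⟨by linarith [hpI.1], hpI.2⟩
      have hp1 : 0 < 1 - p := by linarith [hpI.2]
      have hp0 : 0 < p := by linarith [hpI'.1]
      refine ⟨hd1 p ⟨by linarith [hpI'.1], hpI.2⟩, hd2 p (Or.inr hpI'), ?_⟩
      have ho := hODE2 p hpI'
      have : 0 < l^2*p^2*(1-p)^2/2 * u'' p := by nlinarith
      exact pos_of_mul_pos_right this (by positivity)
  have hu't : ∀ η, b1 < η → η < 1 → u' η = 0 → Tendsto u' (𝓝[>] η) (𝓝 0) := by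
    intro η h1 h2 h3
    have : ContinuousAt u' η := hC1.continuousAt (Ioo_mem_nhds h1 h2)
    have h4 := this.tendsto
    rw [h3] at h4
    exact h4.mono_left nhdsWithin_le_nhds
  -- Step 1
  have step1 : ∀ p ∈ Ioc b1 m, 0 < u p := by
    intro p0 hp0
    by_contra hcon
    push Not at hcon
    have hev := hgrow b1 le_rfl hb1c hub1.ge hu'b1
    obtain ⟨t, ht, htI⟩ := (hev.and (Ioo_mem_nhdsGT hp0.1)).exists
    rw [hub1] at ht
    obtain ⟨η, hη, hmax⟩ := isCompact_Icc.exists_isMaxOn (nonempty_Icc.2 hp0.1.le)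
      (hcont.mono (fun y (hy : y ∈ Icc b1 p0) => ⟨by linarith [hy.1], by linarith [hy.2, hp0.2]⟩))
    have h1 : 0 < u η := ht.trans_le (hmax ⟨htI.1.le, htI.2.le⟩)
    have h2 : b1 < η := lt_of_le_of_ne hη.1 (by rintro rfl; linarith)
    have h3 : η < p0 := lt_of_le_of_ne hη.2 (by rintro rfl; linarith)
    have hηm : η < m := by linarith [hp0.2]
    have hd0 : u' η = 0 :=
      (hmax.isLocalMax (Icc_mem_nhds h2 h3)).hasDerivAt_eq_zero (hd1 η ⟨h2, by linarith⟩)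
    obtain ⟨s, hs, hsI⟩ := ((hgrow η h2.le hηm h1.le (hu't η h2 (by linarith) hd0)).and
      (Ioo_mem_nhdsGT h3)).exists
    have : u s ≤ u η := hmax ⟨by linarith [hsI.1], hsI.2.le⟩
    linarith
  -- Step 2
  intro p0 hp0
  by_contra hcon
  push Not at hcon
  have hmp : m < p0 := by
    by_contra h
    push Not at h
    linarith [step1 p0 ⟨hp0.1, h⟩]
  obtain ⟨q, hq, hmin⟩ := isCompact_Icc.exists_isMinOn (nonempty_Icc.2 hm1.le)
    (hcont.mono (fun y (hy : y ∈ Icc m 1) => ⟨by linarith [hy.1], hy.2⟩))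
  have huq : u q ≤ 0 := (hmin (⟨hmp.le, hp0.2⟩ : p0 ∈ Icc m 1)).trans hcon
  have hqm : m < q := lt_of_le_of_ne hq.1 (by
    intro h; rw [← h] at huq; linarith [step1 m ⟨hb1c, le_rfl⟩])
  have hq1 : q < 1 := lt_of_le_of_ne hq.2 (by intro h; rw [h] at huq; linarith)
  have hqb : b1 < q := hb1c.trans hqm
  have hd0 : u' q = 0 :=
    (hmin.isLocalMin (Icc_mem_nhds hqm hq1)).hasDerivAt_eq_zero (hd1 q ⟨hqb, hq1⟩)
  rcases lt_or_ge q b2 with h2 | h2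
  · have hqc : ContinuousAt u q := hca q (by linarith) hq1
    have hneg : ∀ᶠ p in 𝓝[>] q, r * u p - p * L + c < 0 := by
      have : ContinuousAt (fun p => r * u p - p * L + c) q := by fun_prop
      refine (this.eventually (gt_mem_nhds (?_ : r * u q - q * L + c < 0))).filter_mono
        nhdsWithin_le_nhds
      nlinarith
    have hev := aux_conv (fun p => - u p) (fun p => - u' p) (fun p => - u'' p) q (by
      filter_upwards [hneg, Ioo_mem_nhdsGT h2] with p hp hpI
      have hpI' : p ∈ Ioo b1 b2 := ⟨by linarith [hpI.1], hpI.2⟩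
      have hp1 : 0 < 1 - p := by linarith [hpI.2]
      have hp0 : 0 < p := by linarith [hpI'.1]
      refine ⟨(hd1 p ⟨hpI'.1, by linarith⟩).neg, (hd2 p (Or.inl hpI')).neg, ?_⟩
      have ho := hODE1 p hpI'
      have : 0 < L^2*p^2*(1-p)^2/2 * (- u'' p) := by linarith
      exact pos_of_mul_pos_right this (by positivity)) hqc.neg
      (by simpa using (hu't q hqb hq1 hd0).neg)
    obtain ⟨s, hs, hsI⟩ := (hev.and (Ioo_mem_nhdsGT hq1)).exists
    have : u q ≤ u s := hmin ⟨by linarith [hsI.1], hsI.2.le⟩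
    linarith
  · have hq0 : 0 < q := by linarith
    have key := aux_end (fun p => u p - (p*l-c)/r) (fun p => u' p - l/r) u'' q a hq0 hq1 ha1
      (by
        have : ContinuousOn u (Icc q 1) :=
          hcont.mono (fun y hy => ⟨by linarith [hy.1], hy.2⟩)
        fun_prop)
      (by simp [hu1])
      (by
        have : ContinuousOn u' (Ico q 1) :=
          hC1.mono (fun y hy => ⟨by linarith [hy.1], hy.2⟩)
        fun_prop)
      (by
        intro p hp
        have e := (hd1 p ⟨by linarith [hp.1], hp.2⟩).sub
          ((((hasDerivAt_id p).mul_const l).sub_const c).div_const r)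
        exact e.congr_deriv (by simp))
      (by
        intro p hp
        exact (hd2 p (Or.inr ⟨by linarith [hp.1], hp.2⟩)).sub_const _)
      (by
        intro p hp
        have ho := hODE2 p ⟨by linarith [hp.1], hp.2⟩
        rw [haa]
        field_simp
        linear_combination 2 * ho)
    simp only [hd0] at key
    have e : r * (q*(1-q)*(0 - l/r) + (q+a-1)*(u q - (q*l-c)/r))
        = (q+a-1)*(r * u q) - (q*(a*l-c) - c*(a-1)) := by
      field_simp; ring
    have h5 : 0 ≤ r * (q*(1-q)*(0 - l/r) + (q+a-1)*(u q - (q*l-c)/r)) := mul_nonneg hr.le key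
    rw [e] at h5
    have h6 : 0 < a*l - c := by nlinarith
    have h7 : m * (a*l-c) < q*(a*l-c) := mul_lt_mul_of_pos_right hqm h6
    have h8 : c*(a-1) ≤ m*(a*l-c) := by
      have h10 : m * (L*(a-1)) ≤ m*(a*l-c) :=
        mul_le_mul_of_nonneg_left (by linarith) hm0.le
      calc c*(a-1) = m * (L*(a-1)) := by rw [← mul_assoc, hmL]
        _ ≤ _ := h10
    have h9 : (q+a-1)*(r * u q) ≤ 0 :=
      mul_nonpos_of_nonneg_of_nonpos (by linarith) (mul_nonpos_of_nonneg_of_nonpos hr.le huq)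
    linarith
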